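/- (Theorem 1 / Theorem 2: closed form of the asymptotic variance of the semi-online particle estimator with time-varying parameters.) Assume all densities π_k^s, q_k are strictly positive and f : X^{t+1} → ℝ is measurable with all integrals below finite. Then for every 0 ≤ t ≤ T, the recursively defined functional satisfies V_t(f) = ∫_X (π̄_t^t(x₀))² / q₀(x₀) · ( F₀(x₀) − m )² dλ(x₀) + Σ_{k=1}^{t} ∫_{X^{k+1}} (π̄_t^t(x_{0:k}))² / ( q_k(x_{0:k−1}, x_k) · π_k^{k−1}(x_{0:k−1}) ) · ( F_k(x_{0:k}) − m )² dλ^{⊗(k+1)}(x_{0:k}), where m := ∫ f π_t^t dλ^{⊗(t+1)}, π̄_t^t(x_{0:k}) := ∫ π_t^t(x_{0:t}) dλ^{⊗(t−k)}(x_{k+1:t}) is the marginal, F_k(x_{0:k}) := ∫ f(x_{0:t}) · π_t^t(x_{0:t}) / π̄_t^t(x_{0:k}) dλ^{⊗(t−k)}(x_{k+1:t}) is the conditional expectation of f given x_{0:k} under π_t^t, and F_t := f. -/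

import Mathlib

open MeasureTheory Finset

noncomputable section

/-- The data of a state-space model with a (possibly time-varying) sequence of parameter
values: for each parameter index `k`, an initial density `mu0 k`, a transition density
`m k`, observation likelihoods `g k j` (time `j`), together with proposal densities
`q j` and a reference σ-finite measure `lam`. -/
structure SSData (Xs : Type) [MeasurableSpace Xs] where
  lam : Measure Xs
  mu0 : ℕ → Xs → ℝ
  m : ℕ → Xs → Xs → ℝ
  g : ℕ → ℕ → Xs → ℝ
  q : (j : ℕ) → (Fin j → Xs) → Xs → ℝ

/-- Variance of `h` under the probability density `d` relative to the base measure `ms`. -/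
def Vard {α : Type*} [MeasurableSpace α] (ms : Measure α) (d h : α → ℝ) : ℝ :=
  (∫ x, d x * (h x) ^ 2 ∂ms) - (∫ x, d x * h x ∂ms) ^ 2

namespace SSData

variable {Xs : Type} [MeasurableSpace Xs]

/-- Product reference measure on trajectories of length `n`. -/
def pim (D : SSData Xs) (n : ℕ) : Measure (Fin n → Xs) := Measure.pi fun _ => D.lam

/-- Unnormalized joint density `γ_k^s(x_{0:s})` at parameter index `k` and time `s`. -/
def gam (D : SSData Xs) (k s : ℕ) (x : Fin (s + 1) → Xs) : ℝ :=
  D.mu0 k (x 0) * D.g k 0 (x 0) *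
    ∏ i : Fin s, D.m k (x i.castSucc) (x i.succ) * D.g k ((i : ℕ) + 1) (x i.succ)

/-- Normalizing constant `Z_k^s`. -/
def Z (D : SSData Xs) (k s : ℕ) : ℝ := ∫ x, D.gam k s x ∂(D.pim (s + 1))

/-- Posterior density `π_k^s = γ_k^s / Z_k^s`. -/
def post (D : SSData Xs) (k s : ℕ) (x : Fin (s + 1) → Xs) : ℝ := D.gam k s x / D.Z k s

/-- Retargeting weight `a_t^{t+1} = γ_{t+1}^t / γ_t^t`. -/
def aw (D : SSData Xs) (t : ℕ) (x : Fin (t + 1) → Xs) : ℝ :=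
  D.gam (t + 1) t x / D.gam t t x

/-- Normalized one-step weight: `v₀ = π₀⁰/q₀` and
`v_k = π_k^k / (q_k(x_{0:k-1}, x_k) · π_k^{k-1}(x_{0:k-1}))` for `k ≥ 1`. -/
def vw (D : SSData Xs) : (k : ℕ) → (Fin (k + 1) → Xs) → ℝ
  | 0, x => D.post 0 0 x / D.q 0 (Fin.init x) (x 0)
  | (k + 1), x => D.post (k + 1) (k + 1) x /
      (D.q (k + 1) (Fin.init x) (x (Fin.last (k + 1))) * D.post (k + 1) k (Fin.init x))

/-- Expectation `E_{π_t^t} f`. -/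
def Epost (D : SSData Xs) (t : ℕ) (f : (Fin (t + 1) → Xs) → ℝ) : ℝ :=
  ∫ x, f x * D.post t t x ∂(D.pim (t + 1))

/-- `Ṽ₀(f) = Var_{q₀}(f)`. -/
def Vtilde0 (D : SSData Xs) (f : (Fin 1 → Xs) → ℝ) : ℝ :=
  Vard D.lam (fun y => D.q 0 (fun i => i.elim0) y) (fun y => f (fun _ => y))

/-- One recursion step
`Ṽ_{t+1}(f) = V̂_t( x_{0:t} ↦ ∫ q_{t+1}(x_{0:t},y) f(x_{0:t},y) dλ(y) )
  + ∫ π_{t+1}^t(x_{0:t}) Var_{q_{t+1}(x_{0:t},·)}(f(x_{0:t},·)) dλ^{⊗(t+1)}`,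
expressed given the previous-level functional `Vh = V̂_t`. -/
def VtildeStep (D : SSData Xs) (t : ℕ) (Vh : ((Fin (t + 1) → Xs) → ℝ) → ℝ)
    (f : (Fin (t + 2) → Xs) → ℝ) : ℝ :=
  Vh (fun xs => ∫ y, D.q (t + 1) xs y * f (Fin.snoc xs y) ∂D.lam) +
    ∫ xs, D.post (t + 1) t xs *
      Vard D.lam (fun y => D.q (t + 1) xs y) (fun y => f (Fin.snoc xs y)) ∂(D.pim (t + 1))

/-- The functional `V̂_t(f) = V̄_t(f) + Var_{π_{t+1}^t}(f)`, where
`V̄_t(f) = (Z_t^t/Z_{t+1}^t)² · V_t(a_t^{t+1}·f)` and `V_t(h) = Ṽ_t(v_t·(h − E_{π_t^t} h))`,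
defined by recursion on `t`. -/
def Vhat (D : SSData Xs) : (t : ℕ) → ((Fin (t + 1) → Xs) → ℝ) → ℝ
  | 0 => fun f =>
      (D.Z 0 0 / D.Z 1 0) ^ 2 *
        D.Vtilde0 (fun x => D.vw 0 x *
          (D.aw 0 x * f x - D.Epost 0 (fun y => D.aw 0 y * f y))) +
      Vard (D.pim 1) (D.post 1 0) f
  | (t + 1) => fun f =>
      (D.Z (t + 1) (t + 1) / D.Z (t + 2) (t + 1)) ^ 2 *
        D.VtildeStep t (D.Vhat t) (fun x => D.vw (t + 1) x *
          (D.aw (t + 1) x * f x - D.Epost (t + 1) (fun y => D.aw (t + 1) y * f y))) +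
      Vard (D.pim (t + 2)) (D.post (t + 2) (t + 1)) f

/-- The asymptotic variance functional `V_t(f) = Ṽ_t(v_t·(f − E_{π_t^t} f))` of the
semi-online particle estimator with time-varying parameters. -/
def V (D : SSData Xs) : (t : ℕ) → ((Fin (t + 1) → Xs) → ℝ) → ℝ
  | 0, f => D.Vtilde0 (fun x => D.vw 0 x * (f x - D.Epost 0 f))
  | (t + 1), f => D.VtildeStep t (D.Vhat t) (fun x => D.vw (t + 1) x * (f x - D.Epost (t + 1) f))

/-- Marginal `π̄_t^t(x_{0:k})` of the posterior `π_t^t` over the coordinates `x_{k+1:t}`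
(junk value `0` when `k > t`). -/
def marg (D : SSData Xs) (t k : ℕ) (x : Fin (k + 1) → Xs) : ℝ :=
  if h : k ≤ t then
    ∫ y : Fin (t - k) → Xs,
      D.post t t (fun i => Fin.append x y (Fin.cast (by omega) i)) ∂(D.pim (t - k))
  else 0

/-- Conditional expectation `F_k(x_{0:k}) = ∫ f(x_{0:t}) π_t^t(x_{0:t}) / π̄_t^t(x_{0:k})
dλ^{⊗(t-k)}(x_{k+1:t})` of `f` given `x_{0:k}` under `π_t^t` (junk value `0` when `k > t`). -/
def condExpF (D : SSData Xs) (t k : ℕ) (f : (Fin (t + 1) → Xs) → ℝ)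
    (x : Fin (k + 1) → Xs) : ℝ :=
  if h : k ≤ t then
    ∫ y : Fin (t - k) → Xs,
      f (fun i => Fin.append x y (Fin.cast (by omega) i)) *
        D.post t t (fun i => Fin.append x y (Fin.cast (by omega) i)) / D.marg t k x
      ∂(D.pim (t - k))
  else 0

end SSData

namespace SSData

variable {Xs : Type} [MeasurableSpace Xs]

/-- Integrating out the last `n` coordinates. -/
def Psi (D : SSData Xs) (a n N : ℕ) (h : N = a + n) (φ : (Fin N → Xs) → ℝ)
    (x : Fin a → Xs) : ℝ :=
  ∫ y : Fin n → Xs, φ (fun i => Fin.append x y (Fin.cast h i)) ∂(D.pim n)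

instance (D : SSData Xs) [SigmaFinite D.lam] (n : ℕ) : SigmaFinite (D.pim n) := by
  unfold pim; infer_instance

/-- Snoc as a measurable equivalence. -/
def snocE (Xs : Type) [MeasurableSpace Xs] (n : ℕ) :
    (Fin n → Xs) × Xs ≃ᵐ (Fin (n + 1) → Xs) :=
  MeasurableEquiv.prodComm.trans
    (MeasurableEquiv.piFinSuccAbove (fun _ => Xs) (Fin.last n)).symm

lemma snocE_apply (n : ℕ) (p : (Fin n → Xs) × Xs) :
    snocE Xs n p = Fin.snoc (α := fun _ => Xs) p.1 p.2 := by
  have := Fin.insertNth_last' p.2 p.1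
  simp only [snocE, MeasurableEquiv.trans_apply]
  rw [← this]
  rfl

lemma mp_snoc (D : SSData Xs) [SigmaFinite D.lam] (n : ℕ) :
    MeasurePreserving (snocE Xs n) ((D.pim n).prod D.lam) (D.pim (n + 1)) := by
  have h1 := (measurePreserving_piFinSuccAbove (fun _ : Fin (n + 1) => D.lam) (Fin.last n)).symm
  have h2 : MeasurePreserving (MeasurableEquiv.prodComm : (Fin n → Xs) × Xs ≃ᵐ _)
      ((D.pim n).prod D.lam) (D.lam.prod (D.pim n)) := Measure.measurePreserving_swap
  exact h1.comp h2

/-- Append as a measurable equivalence. -/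
def appE (Xs : Type) [MeasurableSpace Xs] (a n : ℕ) :
    (Fin a → Xs) × (Fin n → Xs) ≃ᵐ (Fin (a + n) → Xs) :=
  (MeasurableEquiv.sumPiEquivProdPi (fun _ : Fin a ⊕ Fin n => Xs)).symm.trans
    (MeasurableEquiv.piCongrLeft (fun _ => Xs) finSumFinEquiv)

lemma appE_apply (a n : ℕ) (p : (Fin a → Xs) × (Fin n → Xs)) :
    appE Xs a n p = Fin.append p.1 p.2 := by
  funext i
  refine Fin.addCases (fun i => ?_) (fun i => ?_) i
  · rw [Fin.append_left, ← finSumFinEquiv_apply_left]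
    exact Equiv.piCongrLeft_apply_apply (fun _ => Xs) finSumFinEquiv _ _
  · rw [Fin.append_right, ← finSumFinEquiv_apply_right]
    exact Equiv.piCongrLeft_apply_apply (fun _ => Xs) finSumFinEquiv _ _

lemma mp_app (D : SSData Xs) [SigmaFinite D.lam] (a n : ℕ) :
    MeasurePreserving (appE Xs a n) ((D.pim a).prod (D.pim n)) (D.pim (a + n)) := by
  have h1 := measurePreserving_sumPiEquivProdPi_symm (fun _ : Fin a ⊕ Fin n => D.lam)
  have h2 := measurePreserving_piCongrLeft (fun _ : Fin (a + n) => D.lam) finSumFinEquiv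
  exact h2.comp h1

lemma int_snoc (D : SSData Xs) [SigmaFinite D.lam] (n : ℕ) {φ : (Fin (n + 1) → Xs) → ℝ}
    (hφ : Integrable φ (D.pim (n + 1))) :
    Integrable (fun p : (Fin n → Xs) × Xs => φ (Fin.snoc p.1 p.2)) ((D.pim n).prod D.lam) := by
  have := ((D.mp_snoc n).integrable_comp_emb (snocE Xs n).measurableEmbedding).2 hφ
  refine this.congr (ae_of_all _ fun p => ?_)
  simp [snocE_apply]

lemma integral_snoc (D : SSData Xs) [SigmaFinite D.lam] (n : ℕ) {φ : (Fin (n + 1) → Xs) → ℝ}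
    (hφ : Integrable φ (D.pim (n + 1))) :
    ∫ xs, ∫ y, φ (Fin.snoc xs y) ∂D.lam ∂(D.pim n) = ∫ x, φ x ∂(D.pim (n + 1)) := by
  rw [← (D.mp_snoc n).integral_comp (snocE Xs n).measurableEmbedding,
    ← integral_prod (fun p : (Fin n → Xs) × Xs => φ (Fin.snoc p.1 p.2)) (D.int_snoc n hφ)]
  simp [snocE_apply]

lemma int_app (D : SSData Xs) [SigmaFinite D.lam] (a n N : ℕ) (h : N = a + n)
    {φ : (Fin N → Xs) → ℝ} (hφ : Integrable φ (D.pim N)) :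
    ∀ᵐ x ∂(D.pim a), Integrable
      (fun y : Fin n → Xs => φ (fun i => Fin.append x y (Fin.cast h i))) (D.pim n) := by
  subst h
  have := ((D.mp_app a n).integrable_comp_emb (appE Xs a n).measurableEmbedding).2 hφ
  have := this.prod_right_ae
  filter_upwards [this] with x hx
  refine hx.congr (ae_of_all _ fun p => ?_)
  simp [appE_apply]

lemma Psi_zero (D : SSData Xs) (N : ℕ) (φ : (Fin N → Xs) → ℝ) (n : ℕ) (hn : n = 0)
    (h : N = N + n) (x : Fin N → Xs) : D.Psi N n N h φ x = φ x := by
  subst hn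
  unfold Psi pim
  rw [Measure.pi_of_empty, integral_dirac]
  congr 1
  funext i
  have := congrFun (Fin.append_right_nil x (default : Fin 0 → Xs) rfl) (Fin.cast h i)
  exact this.trans (congrArg x (Fin.ext rfl))

lemma Psi_snoc (D : SSData Xs) [SigmaFinite D.lam] (a n n' N : ℕ) (h : N = a + n)
    (hn : n' = n + 1) (h' : N + 1 = a + n')
    {φ : (Fin (N + 1) → Xs) → ℝ} (hφ : Integrable φ (D.pim (N + 1))) :
    ∀ᵐ x ∂(D.pim a), D.Psi a n' (N + 1) h' φ x
      = D.Psi a n N h (fun xs => ∫ y, φ (Fin.snoc xs y) ∂D.lam) x := by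
  subst hn
  filter_upwards [D.int_app a (n + 1) (N + 1) h' hφ] with x hx
  subst h
  have := D.integral_snoc n hx
  unfold Psi
  rw [← this]
  refine integral_congr_ae (ae_of_all _ fun y => ?_)
  refine integral_congr_ae (ae_of_all _ fun z => ?_)
  simp only [Fin.append_snoc]
  rfl

lemma V_eq_Vhat (D : SSData Xs) (t : ℕ) (f : (Fin (t + 1) → Xs) → ℝ) :
    D.Vhat t f = (D.Z t t / D.Z (t + 1) t) ^ 2 * D.V t (fun x => D.aw t x * f x) +
      Vard (D.pim (t + 1)) (D.post (t + 1) t) f := by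
  cases t <;> rfl

lemma mp_one (D : SSData Xs) [SigmaFinite D.lam] :
    MeasurePreserving (fun (y : Xs) (_ : Fin 1) => y) D.lam (D.pim 1) := by
  have := (measurePreserving_funUnique D.lam (Fin 1)).symm
  exact this

lemma integral_one (D : SSData Xs) [SigmaFinite D.lam] (φ : (Fin 1 → Xs) → ℝ) :
    ∫ y, φ (fun _ => y) ∂D.lam = ∫ x, φ x ∂(D.pim 1) :=
  D.mp_one.integral_comp (MeasurableEquiv.funUnique (Fin 1) Xs).symm.measurableEmbedding φ

/-- Cauchy-Schwarz with a density. -/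
lemma cs {α : Type*} [MeasurableSpace α] (μ : Measure α) (q φ : α → ℝ) (hq : ∀ y, 0 < q y)
    (hq1 : ∫ y, q y ∂μ = 1) (hφ : Integrable φ μ) (h2 : Integrable (fun y => φ y ^ 2 / q y) μ) :
    (∫ y, φ y ∂μ) ^ 2 ≤ ∫ y, φ y ^ 2 / q y ∂μ := by
  have hqi : Integrable q μ := by
    by_contra h
    rw [integral_undef h] at hq1
    exact zero_ne_one hq1
  set P := ∫ y, φ y ∂μ with hP
  have h0 : 0 ≤ ∫ y, (φ y ^ 2 / q y - 2 * P * φ y) + P ^ 2 * q y ∂μ := by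
    refine integral_nonneg fun y => ?_
    have hy := hq y
    have : φ y ^ 2 / q y - 2 * P * φ y + P ^ 2 * q y = (φ y - P * q y) ^ 2 / q y := by
      field_simp
      ring
    simp only [Pi.zero_apply]
    rw [this]
    positivity
  rw [integral_add (f := fun y => φ y ^ 2 / q y - 2 * P * φ y)
    (h2.sub (hφ.const_mul _)) (hqi.const_mul _), integral_sub h2 (hφ.const_mul _), integral_const_mul, integral_const_mul, hq1, ← hP] at h0
  nlinarith

lemma main (D : SSData Xs) [SigmaFinite D.lam]
    (hqpos : ∀ j xs y, 0 < D.q j xs y)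
    (hqint : ∀ j xs, ∫ y, D.q j xs y ∂D.lam = 1)
    (hZpos : ∀ k s, 0 < D.Z k s)
    (hZfin : ∀ k s, Integrable (D.gam k s) (D.pim (s + 1)))
    (hpostpos : ∀ k s x, 0 < D.post k s x) (t : ℕ) :
    ∀ (f φ : (Fin (t + 1) → Xs) → ℝ) (c : ℝ) (_ : Integrable φ (D.pim (t + 1)))
    (_ : ∫ x, φ x ∂(D.pim (t + 1)) = 0)
    (_ : ∀ x, (f x - D.Epost t f) * D.post t t x = c * φ x)
    (_ : ∀ j, ∀ h : j < t, Integrable (fun x : Fin (j + 2) → Xs =>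
      (D.Psi (j + 2) (t - (j + 1)) (t + 1) (by omega) φ x) ^ 2 /
        (D.q (j + 1) (Fin.init x) (x (Fin.last (j + 1))) * D.post (j + 1) j (Fin.init x)))
      (D.pim (j + 2))),
    D.V t f = c ^ 2 * ((∫ x₀ : Xs, (D.Psi 1 (t - 0) (t + 1) (by omega) φ (fun _ => x₀)) ^ 2
        / D.q 0 (fun i => i.elim0) x₀ ∂D.lam) +
      ∑ j : Fin t, ∫ x : Fin (j + 2) → Xs,
        (D.Psi (j + 2) (t - (j + 1)) (t + 1) (by omega) φ x) ^ 2 /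
        (D.q (j + 1) (Fin.init x) (x (Fin.last (j + 1))) * D.post (j + 1) j (Fin.init x))
          ∂(D.pim (j + 2))) := by
  have hpi : ∀ k s, Integrable (D.post k s) (D.pim (s + 1)) := fun k s => (hZfin k s).div_const _
  induction t with
  | zero =>
    intro f φ c hφ h0 hf hI
    have hin : ∀ y : Xs, Fin.init (fun _ : Fin 1 => y) = (fun i : Fin 0 => i.elim0) :=
      fun y => funext fun i => i.elim0
    have e : ∀ y : Xs, f (fun _ => y) - D.Epost 0 f = c * φ (fun _ => y) / D.post 0 0 (fun _ => y) :=
      fun y => by rw [eq_div_iff (hpostpos _ _ _).ne', hf]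
    have e1 : ∀ y : Xs, D.q 0 (fun i => i.elim0) y *
        (D.vw 0 (fun _ => y) * (f (fun _ => y) - D.Epost 0 f)) = c * φ (fun _ => y) := by
      intro y
      have h1 := (hpostpos 0 0 (fun _ => y)).ne'
      have h2 := (hqpos 0 (fun i => i.elim0) y).ne'
      rw [e, vw, hin]
      field_simp
    have e2 : ∀ y : Xs, D.q 0 (fun i => i.elim0) y *
        (D.vw 0 (fun _ => y) * (f (fun _ => y) - D.Epost 0 f)) ^ 2
        = c ^ 2 * (φ (fun _ => y) ^ 2 / D.q 0 (fun i => i.elim0) y) := by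
      intro y
      have h1 := (hpostpos 0 0 (fun _ => y)).ne'
      have h2 := (hqpos 0 (fun i => i.elim0) y).ne'
      rw [e, vw, hin]
      field_simp
    have hP : ∀ x, D.Psi 1 (0 - 0) (0 + 1) (by omega) φ x = φ x :=
      fun x => D.Psi_zero 1 φ _ rfl _ x
    simp only [V, Vtilde0, Vard, e1, e2, hP, integral_const_mul]
    rw [D.integral_one φ, h0]
    simp
  | succ t ih =>
    intro f φ c hφ h0 hf hI
    set Φ : (Fin (t + 1) → Xs) → ℝ := fun xs => ∫ y, φ (Fin.snoc xs y) ∂D.lam with hΦ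
    have hφs := D.int_snoc (t + 1) hφ
    have hΦi : Integrable Φ (D.pim (t + 1)) := hφs.integral_prod_left
    have hΦ0 : ∫ x, Φ x ∂(D.pim (t + 1)) = 0 := by
      rw [hΦ, D.integral_snoc (t + 1) hφ, h0]
    -- the top term
    set K : (Fin (t + 2) → Xs) → ℝ := fun x => φ x ^ 2 /
        (D.q (t + 1) (Fin.init x) (x (Fin.last (t + 1))) * D.post (t + 1) t (Fin.init x)) with hK
    have hPtop : ∀ x, D.Psi (t + 2) (t + 1 - (t + 1)) (t + 1 + 1) (by omega) φ x = φ x :=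
      fun x => D.Psi_zero (t + 2) φ _ (by omega) _ x
    have hKi : Integrable K (D.pim (t + 2)) := by
      refine (hI t (by omega)).congr (ae_of_all _ fun x => ?_)
      simp only [hPtop, hK]
    have hKs := D.int_snoc (t + 1) hKi
    have hKsn : ∀ xs y, K (Fin.snoc xs y) = φ (Fin.snoc xs y) ^ 2 /
        (D.q (t + 1) xs y * D.post (t + 1) t xs) := by
      intro xs y
      simp only [hK, Fin.init_snoc, Fin.snoc_last]
    have e : ∀ x, f x - D.Epost (t + 1) f = c * φ x / D.post (t + 1) (t + 1) x :=
      fun x => by rw [eq_div_iff (hpostpos _ _ _).ne', hf]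
    have e1 : ∀ xs y, D.q (t + 1) xs y * (D.vw (t + 1) (Fin.snoc xs y) *
        (f (Fin.snoc xs y) - D.Epost (t + 1) f))
        = c / D.post (t + 1) t xs * φ (Fin.snoc xs y) := by
      intro xs y
      have h1 := (hpostpos (t + 1) (t + 1) (Fin.snoc xs y)).ne'
      have h2 := (hqpos (t + 1) xs y).ne'
      have h3 := (hpostpos (t + 1) t xs).ne'
      rw [e, vw, Fin.init_snoc, Fin.snoc_last]
      field_simp
    have e2 : ∀ xs y, D.q (t + 1) xs y * (D.vw (t + 1) (Fin.snoc xs y) *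
        (f (Fin.snoc xs y) - D.Epost (t + 1) f)) ^ 2
        = c ^ 2 / D.post (t + 1) t xs * K (Fin.snoc xs y) := by
      intro xs y
      have h1 := (hpostpos (t + 1) (t + 1) (Fin.snoc xs y)).ne'
      have h2 := (hqpos (t + 1) xs y).ne'
      have h3 := (hpostpos (t + 1) t xs).ne'
      rw [e, vw, Fin.init_snoc, Fin.snoc_last, hKsn]
      field_simp
    -- Jensen
    have hJ : ∀ᵐ xs ∂(D.pim (t + 1)),
        Φ xs ^ 2 / D.post (t + 1) t xs ≤ ∫ y, K (Fin.snoc xs y) ∂D.lam := by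
      filter_upwards [hφs.prod_right_ae, hKs.prod_right_ae] with xs h1 h2
      have h3 := hpostpos (t + 1) t xs
      have hk : ∀ y, K (Fin.snoc xs y) =
          φ (Fin.snoc xs y) ^ 2 / D.q (t + 1) xs y / D.post (t + 1) t xs := by
        intro y; rw [hKsn, div_div]
      simp only [hk] at h2 ⊢
      rw [integral_div]
      refine div_le_div_of_nonneg_right ?_ h3.le
      refine cs D.lam _ _ (hqpos _ _) (hqint _ _) h1 ?_
      refine (h2.mul_const (D.post (t + 1) t xs)).congr (ae_of_all _ fun y => ?_)
      simp only
      rw [div_mul_cancel₀ _ h3.ne']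
    have hAi : Integrable (fun xs => ∫ y, K (Fin.snoc xs y) ∂D.lam) (D.pim (t + 1)) :=
      hKs.integral_prod_left
    have hBi : Integrable (fun xs => Φ xs ^ 2 / D.post (t + 1) t xs) (D.pim (t + 1)) := by
      refine hAi.mono' ?_ ?_
      · exact (((hΦi.1.aemeasurable).pow_const 2).div (hpi (t + 1) t).1.aemeasurable).aestronglyMeasurable
      · filter_upwards [hJ] with xs h
        rwa [Real.norm_of_nonneg]
        have := hpostpos (t + 1) t xs
        positivity
    -- the step
    have hZ1 := (hZpos t t).ne'
    have hZ2 := (hZpos (t + 1) t).ne'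
    have hB : ∀ x, (D.aw t x * (c / D.post (t + 1) t x * Φ x)) * D.post t t x
        = D.Z (t + 1) t / D.Z t t * c * Φ x := by
      intro x
      have h1 := (hpostpos (t + 1) t x).ne'
      have h2 := (hpostpos t t x).ne'
      unfold post at h1 h2
      have h1' := (div_ne_zero_iff.1 h1).1
      have h2' := (div_ne_zero_iff.1 h2).1
      unfold aw post
      field_simp
    have hE : D.Epost t (fun x => D.aw t x * (c / D.post (t + 1) t x * Φ x)) = 0 := by
      unfold Epost
      simp only [hB, integral_const_mul, hΦ0, mul_zero]
    have hPs : ∀ j, ∀ h : j < t, ∀ᵐ x ∂(D.pim (j + 2)),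
        D.Psi (j + 2) (t + 1 - (j + 1)) (t + 1 + 1) (by omega) φ x
        = D.Psi (j + 2) (t - (j + 1)) (t + 1) (by omega) Φ x := fun j h =>
      D.Psi_snoc (j + 2) (t - (j + 1)) _ (t + 1) (by omega) (by omega) (by omega) hφ
    have hP0 : ∀ᵐ x ∂(D.pim 1),
        D.Psi 1 (t + 1 - 0) (t + 1 + 1) (by omega) φ x
        = D.Psi 1 (t - 0) (t + 1) (by omega) Φ x :=
      D.Psi_snoc 1 (t - 0) _ (t + 1) (by omega) (by omega) (by omega) hφ
    have hIH := ih (fun x => D.aw t x * (c / D.post (t + 1) t x * Φ x)) Φ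
      (D.Z (t + 1) t / D.Z t t * c) hΦi hΦ0 (fun x => by rw [hE, sub_zero, hB])
      (fun j h => by
        refine (hI j (by omega)).congr ?_
        filter_upwards [hPs j h] with x hx
        rw [hx])
    have hv1 : ∀ xs, D.post (t + 1) t xs * (c / D.post (t + 1) t xs * Φ xs) = c * Φ xs := by
      intro xs
      have h1 := (hpostpos (t + 1) t xs).ne'
      field_simp
    have hv2 : ∀ xs, D.post (t + 1) t xs * (c / D.post (t + 1) t xs * Φ xs) ^ 2
        = c ^ 2 * (Φ xs ^ 2 / D.post (t + 1) t xs) := by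
      intro xs
      have h1 := (hpostpos (t + 1) t xs).ne'
      field_simp
    have hv3 : ∀ xs, D.post (t + 1) t xs * (c ^ 2 / D.post (t + 1) t xs *
        (∫ y, K (Fin.snoc xs y) ∂D.lam) - (c / D.post (t + 1) t xs * Φ xs) ^ 2)
        = c ^ 2 * ((∫ y, K (Fin.snoc xs y) ∂D.lam) - Φ xs ^ 2 / D.post (t + 1) t xs) := by
      intro xs
      have h1 := (hpostpos (t + 1) t xs).ne'
      field_simp
    have hΦe : ∀ xs, ∫ y, φ (Fin.snoc xs y) ∂D.lam = Φ xs := fun xs => rfl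
    have hV : D.V (t + 1) f = (D.Z t t / D.Z (t + 1) t) ^ 2 *
        D.V t (fun x => D.aw t x * (c / D.post (t + 1) t x * Φ x)) +
        c ^ 2 * ∫ x, K x ∂(D.pim (t + 2)) := by
      have hVd : D.V (t + 1) f = D.VtildeStep t (D.Vhat t)
        (fun x => D.vw (t + 1) x * (f x - D.Epost (t + 1) f)) := rfl
      rw [hVd]
      simp only [VtildeStep, Vard, e1, e2, integral_const_mul, hΦe]
      rw [V_eq_Vhat]
      simp only [Vard, hv1, hv2, hv3, integral_const_mul, hΦ0]
      rw [integral_sub hAi hBi, D.integral_snoc (t + 1) hKi]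
      ring
    rw [hV, hIH, Fin.sum_univ_castSucc]
    have t0 : ∫ x₀ : Xs, (D.Psi 1 (t - 0) (t + 1) (by omega) Φ (fun _ => x₀)) ^ 2
        / D.q 0 (fun i => i.elim0) x₀ ∂D.lam =
        ∫ x₀ : Xs, (D.Psi 1 (t + 1 - 0) (t + 1 + 1) (by omega) φ (fun _ => x₀)) ^ 2
        / D.q 0 (fun i => i.elim0) x₀ ∂D.lam := by
      refine integral_congr_ae ?_
      filter_upwards [D.mp_one.quasiMeasurePreserving.ae hP0] with x hx
      rw [hx]
    have t1 : ∀ j : Fin t, ∫ x : Fin ((j : ℕ) + 2) → Xs,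
        (D.Psi (j + 2) (t - (j + 1)) (t + 1) (by omega) Φ x) ^ 2 /
        (D.q (j + 1) (Fin.init x) (x (Fin.last (j + 1))) * D.post (j + 1) j (Fin.init x))
          ∂(D.pim (j + 2)) = ∫ x : Fin ((j : ℕ) + 2) → Xs,
        (D.Psi (j + 2) (t + 1 - (j + 1)) (t + 1 + 1) (by omega) φ x) ^ 2 /
        (D.q (j + 1) (Fin.init x) (x (Fin.last (j + 1))) * D.post (j + 1) j (Fin.init x))
          ∂(D.pim (j + 2)) := by
      intro j
      refine integral_congr_ae ?_
      filter_upwards [hPs j j.2] with x hx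
      rw [hx]
    have t2 : ∫ x, K x ∂(D.pim (t + 2)) = ∫ x : Fin (t + 2) → Xs,
        (D.Psi (t + 2) (t + 1 - (t + 1)) (t + 1 + 1) (by omega) φ x) ^ 2 /
        (D.q (t + 1) (Fin.init x) (x (Fin.last (t + 1))) * D.post (t + 1) t (Fin.init x))
          ∂(D.pim (t + 2)) := by
      simp only [hPtop, hK]
    rw [t0, Finset.sum_congr rfl (fun j _ => t1 j), t2]
    simp only [Fin.val_castSucc, Fin.val_last]
    field_simp
    ring

lemma marg_cond (D : SSData Xs) [SigmaFinite D.lam]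
    (hZpos : ∀ k s, 0 < D.Z k s)
    (hpi : ∀ k s, Integrable (D.post k s) (D.pim (s + 1)))
    (hpostpos : ∀ k s x, 0 < D.post k s x) (t k : ℕ) (hk : k ≤ t)
    (f : (Fin (t + 1) → Xs) → ℝ) (c : ℝ)
    (hint0 : Integrable (fun x => f x * D.post t t x) (D.pim (t + 1))) :
    ∀ᵐ x ∂(D.pim (k + 1)), ∀ d : ℝ, (D.marg t k x) ^ 2 / d * (D.condExpF t k f x - c) ^ 2
      = (D.Psi (k + 1) (t - k) (t + 1) (by omega) (fun x => (f x - c) * D.post t t x) x) ^ 2 / d := by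
  have hlam : D.lam ≠ 0 := by
    intro h
    have := hZpos 0 0
    rw [Z, ← D.integral_one, h, integral_zero_measure] at this
    exact this.false
  have hpim : D.pim (t - k) ≠ 0 := by
    intro h
    have h2 : D.pim (t - k) Set.univ = 0 := by rw [h]; simp
    rw [pim, Measure.pi_univ, Finset.prod_eq_zero_iff] at h2
    obtain ⟨_, _, h3⟩ := h2
    exact hlam (Measure.measure_univ_eq_zero.1 h3)
  have hh : t + 1 = k + 1 + (t - k) := by omega
  filter_upwards [D.int_app (k + 1) (t - k) (t + 1) hh hint0,
    D.int_app (k + 1) (t - k) (t + 1) hh (hpi t t)] with x h1 h2 d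
  have hm : 0 < D.marg t k x := by
    rw [marg, dif_pos hk]
    rw [integral_pos_iff_support_of_nonneg (fun y => (hpostpos _ _ _).le) h2]
    rw [Function.support_eq_univ fun y => (hpostpos _ _ _).ne']
    exact pos_iff_ne_zero.2 (fun h => hpim (Measure.measure_univ_eq_zero.1 h))
  have hP : D.Psi (k + 1) (t - k) (t + 1) hh (fun x => (f x - c) * D.post t t x) x
      = D.marg t k x * (D.condExpF t k f x - c) := by
    have hm' := hm.ne'
    rw [condExpF, dif_pos hk, integral_div, mul_sub, mul_div_cancel₀ _ hm']
    unfold Psi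
    simp only [sub_mul]
    rw [integral_sub h1 (h2.const_mul c), integral_const_mul]
    rw [marg, dif_pos hk]
    ring
  rw [hP]
  ring

end SSData

/-- Theorem 1 / Theorem 2: closed form of the asymptotic variance of the
semi-online particle estimator with time-varying parameters. Assuming all densities
`π_k^s`, `q_k` are strictly positive and `f` is measurable with the relevant integrals
finite, for every `0 ≤ t ≤ T`,
`V_t(f) = ∫ (π̄_t^t(x₀))²/q₀(x₀) (F₀(x₀) − m)² dλ(x₀)
  + Σ_{k=1}^t ∫ (π̄_t^t(x_{0:k}))² / (q_k(x_{0:k-1},x_k) π_k^{k-1}(x_{0:k-1}))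
      (F_k(x_{0:k}) − m)² dλ^{⊗(k+1)}(x_{0:k})`,
with `m = E_{π_t^t} f` and `F_k` the conditional expectation of `f` given `x_{0:k}`. -/
theorem semi_online_asymptotic_variance
    {Xs : Type} [MeasurableSpace Xs] (D : SSData Xs) [SigmaFinite D.lam]
    (hmu0m : ∀ k, Measurable (D.mu0 k)) (hmm : ∀ k, Measurable (Function.uncurry (D.m k)))
    (hgm : ∀ k j, Measurable (D.g k j))
    (hmint : ∀ k x, ∫ y, D.m k x y ∂D.lam = 1)
    (hqpos : ∀ j xs y, 0 < D.q j xs y)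
    (hqint : ∀ j xs, ∫ y, D.q j xs y ∂D.lam = 1)
    (hZpos : ∀ k s, 0 < D.Z k s)
    (hZfin : ∀ k s, Integrable (D.gam k s) (D.pim (s + 1)))
    (hpostpos : ∀ k s x, 0 < D.post k s x)
    (T : ℕ) (hT : 1 ≤ T) (t : ℕ) (htT : t ≤ T)
    (f : (Fin (t + 1) → Xs) → ℝ) (hfm : Measurable f)
    (mE : ℝ) (hmE : mE = D.Epost t f)
    (hint0 : Integrable (fun x => f x * D.post t t x) (D.pim (t + 1)))
    (hint1 : Integrable (fun x₀ : Xs =>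
      (D.marg t 0 (fun _ => x₀)) ^ 2 / D.q 0 (fun i => i.elim0) x₀ *
        (D.condExpF t 0 f (fun _ => x₀) - mE) ^ 2) D.lam)
    (hint2 : ∀ j < t, Integrable (fun x : Fin (j + 2) → Xs =>
      (D.marg t (j + 1) x) ^ 2 /
          (D.q (j + 1) (Fin.init x) (x (Fin.last (j + 1))) * D.post (j + 1) j (Fin.init x)) *
        (D.condExpF t (j + 1) f x - mE) ^ 2) (D.pim (j + 2))) :
    D.V t f =
      (∫ x₀ : Xs, (D.marg t 0 (fun _ => x₀)) ^ 2 / D.q 0 (fun i => i.elim0) x₀ *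
          (D.condExpF t 0 f (fun _ => x₀) - mE) ^ 2 ∂D.lam) +
      ∑ j ∈ Finset.range t,
        ∫ x : Fin (j + 2) → Xs, (D.marg t (j + 1) x) ^ 2 /
            (D.q (j + 1) (Fin.init x) (x (Fin.last (j + 1))) *
              D.post (j + 1) j (Fin.init x)) *
          (D.condExpF t (j + 1) f x - mE) ^ 2 ∂(D.pim (j + 2)) := by
  have hpi : ∀ k s, Integrable (D.post k s) (D.pim (s + 1)) := fun k s => (hZfin k s).div_const _
  have hp1 : ∫ x, D.post t t x ∂(D.pim (t + 1)) = 1 := by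
    unfold SSData.post
    rw [integral_div]
    exact div_self (hZpos t t).ne'
  have hc := fun k (hk : k ≤ t) => D.marg_cond hZpos hpi hpostpos t k hk f mE hint0
  have hφi : Integrable (fun x => (f x - mE) * D.post t t x) (D.pim (t + 1)) := by
    simp only [sub_mul]
    exact hint0.sub ((hpi t t).const_mul mE)
  have hφ0 : ∫ x, (f x - mE) * D.post t t x ∂(D.pim (t + 1)) = 0 := by
    simp only [sub_mul]
    rw [integral_sub hint0 ((hpi t t).const_mul mE), integral_const_mul, hp1, hmE, SSData.Epost]
    ring
  have key := D.main hqpos hqint hZpos hZfin hpostpos t f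
    (fun x => (f x - mE) * D.post t t x) 1 hφi hφ0 (fun x => by rw [hmE, one_mul])
    (fun j h => by
      refine (hint2 j h).congr ?_
      filter_upwards [hc (j + 1) h] with x hx
      exact hx _)
  rw [key, one_pow, one_mul, Finset.sum_range]
  congr 1
  · refine integral_congr_ae ?_
    filter_upwards [D.mp_one.quasiMeasurePreserving.ae (hc 0 (Nat.zero_le t))] with x hx
    exact (hx _).symm
  · refine Finset.sum_congr rfl fun j _ => ?_
    refine integral_congr_ae ?_
    filter_upwards [hc (j + 1) j.2] with x hx
    exact (hx _).symm

end
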